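/- For every linearly independent subset $X$ of a finite multiset of vectors $\{\beta_1,\dots,\beta_r\} \subseteq \mathbb{Z}^n$, and every positive integer $t$, the Ehrhart count of the zonotope $\mathcal{Z} = \sum_{i=1}^r \operatorname{conv}\{0,\beta_i\}$ satisfies $\#(t\mathcal{Z} \cap \mathbb{Z}^n) = \sum_X h(X)\, t^{|X|}$, where the sum is over linearly independent subsets $X$ of the multiset, $h(X) = [\Lambda_X : \Gamma_X]$, $\Gamma_X$ is the subgroup of $\mathbb{Z}^n$ generated by $X$, and $\Lambda_X = \operatorname{span}_\mathbb{R}(X) \cap \mathbb{Z}^n$. -/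

import Mathlib

open Finset MeasureTheory Pointwise

open scoped Classical in
/-- The coefficientwise inclusion `ℤ^n → ℝ^n`, as a `ℤ`-linear map. -/
def intCast (n : ℕ) : (Fin n → ℤ) →ₗ[ℤ] (Fin n → ℝ) :=
  LinearMap.pi fun i => ((Int.castAddHom ℝ).toIntLinearMap).comp (LinearMap.proj i)

/-- For a subset `X` of the (index set of the) multiset `{β 0, …, β (r-1)} ⊆ ℤ^n`,
the index `h(X) = [Λ_X : Γ_X]`, where `Γ_X` is the sublattice of `ℤ^n` generated by
`X` and `Λ_X = span_ℝ(X) ∩ ℤ^n`. -/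
noncomputable def hIndex (n r : ℕ) (β : Fin r → (Fin n → ℤ)) (X : Finset (Fin r)) : ℕ :=
  Nat.card
    ((Submodule.comap (intCast n)
        ((Submodule.span ℝ ((fun i => intCast n (β i)) '' (X : Set (Fin r)))).restrictScalars ℤ)) ⧸
      Submodule.comap
        (Submodule.comap (intCast n)
          ((Submodule.span ℝ
            ((fun i => intCast n (β i)) '' (X : Set (Fin r)))).restrictScalars ℤ)).subtype
        (Submodule.span ℤ (β '' (X : Set (Fin r)))))

section Zonotope

variable {ι V L : Type*}

section Slab

variable [NormedAddCommGroup V] [NormedSpace ℝ V]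

/-- The Minkowski sum of the zonotope `∑ i ∈ S, [0, t • w i]` and the real span of the vectors
`w i`, `i ∈ A`. -/
def zonotopeSlab (w : ι → V) (t : ℕ) (A S : Finset ι) : Set V :=
  {v | ∃ c : ι → ℝ, (∀ i, c i ∈ Set.Icc (0 : ℝ) t) ∧
    v - ∑ i ∈ S, c i • w i ∈ Submodule.span ℝ (w '' (A : Set ι))}

lemma add_mem_zonotopeSlab {w : ι → V} {t : ℕ} {A S : Finset ι} {v u : V}
    (hu : u ∈ Submodule.span ℝ (w '' (A : Set ι))) (hv : v ∈ zonotopeSlab w t A S) :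
    v + u ∈ zonotopeSlab w t A S := by
  obtain ⟨c, hc, h⟩ := hv
  refine ⟨c, hc, ?_⟩
  rw [add_sub_right_comm]
  exact add_mem h hu

lemma add_mem_zonotopeSlab_iff {w : ι → V} {t : ℕ} {A S : Finset ι} {v u : V}
    (hu : u ∈ Submodule.span ℝ (w '' (A : Set ι))) :
    v + u ∈ zonotopeSlab w t A S ↔ v ∈ zonotopeSlab w t A S :=
  ⟨fun h => by simpa using add_mem_zonotopeSlab (neg_mem hu) h, add_mem_zonotopeSlab hu⟩

lemma zonotopeSlab_empty (w : ι → V) (t : ℕ) (A : Finset ι) :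
    zonotopeSlab w t A ∅ = Submodule.span ℝ (w '' (A : Set ι)) := by
  ext v
  simp only [zonotopeSlab, Finset.sum_empty, sub_zero, Set.mem_ofPred_eq, SetLike.mem_coe]
  exact ⟨fun ⟨_, _, h⟩ => h, fun h => ⟨fun _ => 0, fun _ => by simp, h⟩⟩

lemma convex_zonotopeSlab (w : ι → V) (t : ℕ) (A S : Finset ι) :
    Convex ℝ (zonotopeSlab w t A S) := by
  rintro v ⟨c, hc, hv⟩ u ⟨d, hd, hu⟩ p q hp hq hpq
  refine ⟨fun i => p • c i + q • d i, fun i => convex_Icc _ _ (hc i) (hd i) hp hq hpq, ?_⟩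
  convert add_mem (Submodule.smul_mem _ p hv) (Submodule.smul_mem _ q hu) using 1
  simp only [smul_sub, Finset.smul_sum, add_smul, Finset.sum_add_distrib, smul_assoc]
  abel

variable [DecidableEq ι]

lemma mem_zonotopeSlab_insert {w : ι → V} {t : ℕ} {A S : Finset ι} {b : ι} (hb : b ∉ S) {v : V} :
    v ∈ zonotopeSlab w t A (insert b S) ↔
      ∃ s ∈ Set.Icc (0 : ℝ) t, v - s • w b ∈ zonotopeSlab w t A S := by
  constructor
  · rintro ⟨c, hc, h⟩
    refine ⟨c b, hc b, c, hc, ?_⟩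
    rwa [sub_sub, ← Finset.sum_insert (f := fun i => c i • w i) hb]
  · rintro ⟨s, hs, c, hc, h⟩
    refine ⟨Function.update c b s, fun i => ?_, ?_⟩
    · by_cases hi : i = b
      · subst hi; simpa using hs
      · simpa [hi] using hc i
    · rw [Finset.sum_insert hb, ← sub_sub, Function.update_self]
      convert h using 2
      refine Finset.sum_congr rfl fun i hi => ?_
      rw [Function.update_of_ne (ne_of_mem_of_not_mem hi hb)]

lemma mem_zonotopeSlab_insert_left {w : ι → V} {t : ℕ} {A S : Finset ι} {b : ι} {v : V} :
    v ∈ zonotopeSlab w t (insert b A) S ↔ ∃ s : ℝ, v + s • w b ∈ zonotopeSlab w t A S := by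
  constructor
  · rintro ⟨c, hc, h⟩
    rw [Finset.coe_insert, Set.image_insert_eq, Submodule.mem_span_insert] at h
    obtain ⟨a, z, hz, h⟩ := h
    refine ⟨-a, c, hc, ?_⟩
    convert hz using 1
    rw [add_sub_right_comm, h]
    module
  · rintro ⟨s, c, hc, h⟩
    refine ⟨c, hc, ?_⟩
    rw [Finset.coe_insert, Set.image_insert_eq, Submodule.mem_span_insert]
    refine ⟨-s, _, h, ?_⟩
    module

/-- Among the translates of `v` along `w b` lying in a slab transverse to `w b`, there is a
furthest one. -/
lemma exists_isGreatest_zonotopeSlab [FiniteDimensional ℝ V] {w : ι → V} {t : ℕ} {A S : Finset ι}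
    {b : ι} (hb : w b ∉ Submodule.span ℝ (w '' (A : Set ι))) {v : V}
    (hv : v ∈ zonotopeSlab w t (insert b A) S) :
    ∃ γ : ℝ, IsGreatest {s : ℝ | v + s • w b ∈ zonotopeSlab w t A S} γ := by
  obtain ⟨f, hfb, hfA⟩ := Submodule.exists_le_ker_of_notMem hb
  have key : ∀ (s : ℝ) (c : ι → ℝ),
      v + s • w b - ∑ i ∈ S, c i • w i ∈ Submodule.span ℝ (w '' (A : Set ι)) →
      s = (f (∑ i ∈ S, c i • w i) - f v) / f (w b) := by
    intro s c h
    have h0 : f (v + s • w b - ∑ i ∈ S, c i • w i) = 0 := hfA h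
    rw [map_sub, map_add, map_smul, smul_eq_mul] at h0
    rw [eq_div_iff hfb]
    linarith
  let K : Set (ι → ℝ) := Set.pi Set.univ (fun _ => Set.Icc (0 : ℝ) t) ∩
    (fun c => v - ∑ i ∈ S, c i • w i) ⁻¹'
      (Submodule.span ℝ (w '' ((insert b A : Finset ι) : Set ι)) : Set V)
  have hcont : Continuous fun c : ι → ℝ => ∑ i ∈ S, c i • w i := by fun_prop
  have hf : Continuous f := f.continuous_of_finiteDimensional
  have hK : IsCompact K :=
    (isCompact_univ_pi fun _ => isCompact_Icc).inter_right
      ((Submodule.closed_of_finiteDimensional _).preimage (continuous_const.sub hcont))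
  have hne : K.Nonempty := by
    obtain ⟨c, hc, h⟩ := hv
    exact ⟨c, fun i _ => hc i, h⟩
  obtain ⟨c, hcK, hmax⟩ := hK.exists_isMaxOn hne
    (f := fun c => (f (∑ i ∈ S, c i • w i) - f v) / f (w b)) (by fun_prop)
  refine ⟨(f (∑ i ∈ S, c i • w i) - f v) / f (w b), ?_, ?_⟩
  · obtain ⟨hc, h⟩ := hcK
    rw [Set.mem_preimage, SetLike.mem_coe, Finset.coe_insert, Set.image_insert_eq,
      Submodule.mem_span_insert] at h
    obtain ⟨a, z, hz, h⟩ := h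
    have h1 : v + (-a) • w b - ∑ i ∈ S, c i • w i ∈ Submodule.span ℝ (w '' (A : Set ι)) := by
      convert hz using 1
      rw [add_sub_right_comm, h]
      module
    rw [← key _ _ h1]
    exact ⟨c, fun i => hc i trivial, h1⟩
  · rintro s ⟨d, hd, h⟩
    rw [key s d h]
    refine hmax (a := d) ⟨fun i _ => hd i, ?_⟩
    rw [Set.mem_preimage, SetLike.mem_coe, Finset.coe_insert, Set.image_insert_eq,
      Submodule.mem_span_insert]
    exact ⟨-s, _, h, by module⟩

/-- Adjoining a generator transverse to the slab lengthens each line in its direction by `t`. -/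
lemma mem_zonotopeSlab_insert_diff_iff {w : ι → V} {t : ℕ} {A S : Finset ι} {b : ι} (hbS : b ∉ S)
    {v : V} {γ : ℝ} (hγ : IsGreatest {s : ℝ | v + s • w b ∈ zonotopeSlab w t A S} γ) (k : ℝ) :
    (v + k • w b ∈ zonotopeSlab w t A (insert b S) ∧ v + k • w b ∉ zonotopeSlab w t A S) ↔
      γ < k ∧ k ≤ γ + t := by
  rw [mem_zonotopeSlab_insert hbS]
  constructor
  · rintro ⟨⟨s, hs, h⟩, hk⟩
    have h1 : k - s ∈ {s : ℝ | v + s • w b ∈ zonotopeSlab w t A S} := by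
      rw [Set.mem_ofPred_eq]
      convert h using 1
      module
    have h2 := hγ.2 h1
    refine ⟨?_, by linarith [hs.2]⟩
    by_contra! hle
    apply hk
    have hconv : Convex ℝ {s : ℝ | v + s • w b ∈ zonotopeSlab w t A S} := by
      intro x hx y hy p q hp hq hpq
      have := convex_zonotopeSlab w t A S hx hy hp hq hpq
      rw [Set.mem_ofPred_eq]
      convert this using 1
      obtain rfl : q = 1 - p := by linarith
      simp only [smul_eq_mul]
      module
    exact hconv.ordConnected.out h1 hγ.1 ⟨by linarith [hs.1], hle⟩
  · rintro ⟨h1, h2⟩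
    refine ⟨⟨k - γ, ⟨by linarith, by linarith⟩, ?_⟩, fun h => absurd (hγ.2 h) (not_le.2 h1)⟩
    have h3 : v + k • w b - (k - γ) • w b = v + γ • w b := by module
    rw [h3]
    exact hγ.1

end Slab

variable [NormedAddCommGroup V] [NormedSpace ℝ V] [AddCommGroup L]

/-- The points of the slab `zonotopeSlab (φ ∘ β) t A S` coming from `L`, modulo the subgroup
generated by the vectors `β i`, `i ∈ A`. -/
def slabClasses (φ : L →ₗ[ℤ] V) (β : ι → L) (t : ℕ) (A S : Finset ι) :
    Set (L ⧸ Submodule.span ℤ (β '' (A : Set ι))) :=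
  Submodule.Quotient.mk '' {x | φ x ∈ zonotopeSlab (φ ∘ β) t A S}

lemma map_mem_span_of_mem_span (φ : L →ₗ[ℤ] V) (β : ι → L) {s : Set ι} {a : L}
    (ha : a ∈ Submodule.span ℤ (β '' s)) : φ a ∈ Submodule.span ℝ ((φ ∘ β) '' s) := by
  have h := Submodule.mem_map_of_mem (f := φ) ha
  rw [Submodule.map_span, ← Set.image_comp] at h
  exact Submodule.span_subset_span ℤ ℝ _ h

lemma mk_mem_slabClasses {φ : L →ₗ[ℤ] V} {β : ι → L} {t : ℕ} {A S : Finset ι} {x : L} :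
    (Submodule.Quotient.mk x : L ⧸ Submodule.span ℤ (β '' (A : Set ι))) ∈ slabClasses φ β t A S ↔
      φ x ∈ zonotopeSlab (φ ∘ β) t A S := by
  refine ⟨?_, fun h => ⟨x, h, rfl⟩⟩
  rintro ⟨y, hy, h⟩
  have := map_mem_span_of_mem_span φ β ((Submodule.Quotient.eq _).1 h.symm)
  have := add_mem_zonotopeSlab this hy
  simpa using this

lemma finite_slabClasses {φ : L →ₗ[ℤ] V} (hφ : ∀ M : ℝ, {x | ‖φ x‖ ≤ M}.Finite) (β : ι → L)
    (t : ℕ) (A S : Finset ι) : (slabClasses φ β t A S).Finite := by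
  refine ((hφ (∑ i ∈ S, t * ‖φ (β i)‖ + ∑ i ∈ A, ‖φ (β i)‖)).image
    Submodule.Quotient.mk).subset ?_
  rintro _ ⟨x, ⟨c, hc, h⟩, rfl⟩
  rw [Submodule.mem_span_image_finset_iff_exists_fun'] at h
  obtain ⟨d, hd⟩ := h
  refine ⟨x - ∑ i ∈ A, ⌊d i⌋ • β i, ?_, ?_⟩
  · have h1 : φ (x - ∑ i ∈ A, ⌊d i⌋ • β i) =
        ∑ i ∈ S, c i • φ (β i) + ∑ i ∈ A, Int.fract (d i) • φ (β i) := by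
      simp only [Int.fract, sub_smul, Finset.sum_sub_distrib, map_sub, map_sum, map_zsmul,
        Int.cast_smul_eq_zsmul]
      simp only [Function.comp_apply] at hd
      rw [hd]
      abel
    rw [Set.mem_ofPred_eq, h1]
    refine (norm_add_le _ _).trans (add_le_add ?_ ?_)
    · refine norm_sum_le_of_le _ fun i _ => ?_
      rw [norm_smul, Real.norm_of_nonneg (hc i).1]
      exact mul_le_mul_of_nonneg_right (hc i).2 (norm_nonneg _)
    · refine norm_sum_le_of_le _ fun i _ => ?_
      rw [norm_smul, Real.norm_of_nonneg (Int.fract_nonneg _)]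
      exact mul_le_of_le_one_left (norm_nonneg _) (Int.fract_lt_one _).le
  · rw [Submodule.Quotient.eq]
    rw [sub_sub_cancel_left]
    exact neg_mem (Submodule.sum_mem _ fun i hi =>
      Submodule.smul_mem _ _ (Submodule.subset_span ⟨i, hi, rfl⟩))

variable [DecidableEq ι]

lemma slabClasses_insert_of_mem_span {φ : L →ₗ[ℤ] V} {β : ι → L} {t : ℕ} {A S : Finset ι} {b : ι}
    (hbS : b ∉ S) (hb : φ (β b) ∈ Submodule.span ℝ ((φ ∘ β) '' (A : Set ι))) :
    slabClasses φ β t A (insert b S) = slabClasses φ β t A S := by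
  unfold slabClasses
  congr 1
  ext x
  simp only [Set.mem_ofPred_eq, mem_zonotopeSlab_insert hbS, Function.comp_apply]
  constructor
  · rintro ⟨s, -, h⟩
    rw [sub_eq_add_neg] at h
    exact (add_mem_zonotopeSlab_iff (neg_mem (Submodule.smul_mem _ s hb))).1 h
  · intro h
    exact ⟨0, by simp, by simpa using h⟩

lemma slabClasses_subset_insert {φ : L →ₗ[ℤ] V} {β : ι → L} {t : ℕ} {A S : Finset ι} {b : ι}
    (hbS : b ∉ S) : slabClasses φ β t A S ⊆ slabClasses φ β t A (insert b S) := by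
  refine Set.image_mono fun x hx => ?_
  exact (mem_zonotopeSlab_insert hbS).2 ⟨0, by simp, by simpa using hx⟩

lemma card_slabClasses_insert_diff [FiniteDimensional ℝ V] {φ : L →ₗ[ℤ] V} {β : ι → L} {t : ℕ}
    {A S : Finset ι} {b : ι} (hbS : b ∉ S)
    (hb : φ (β b) ∉ Submodule.span ℝ ((φ ∘ β) '' (A : Set ι))) :
    Nat.card ↑(slabClasses φ β t A (insert b S) \ slabClasses φ β t A S) =
      Nat.card (slabClasses φ β t (insert b A) S) * t := by
  have exists_lift : ∀ q : slabClasses φ β t (insert b A) S, ∃ y : L,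
      Submodule.Quotient.mk y = q.1 ∧ ∀ k : ℤ,
        (φ (y + k • β b) ∈ zonotopeSlab (φ ∘ β) t A (insert b S) ∧
          φ (y + k • β b) ∉ zonotopeSlab (φ ∘ β) t A S) ↔ 0 ≤ k ∧ k < t := by
    rintro ⟨_, x, hx, rfl⟩
    obtain ⟨γ, hγ⟩ := exists_isGreatest_zonotopeSlab hb hx
    refine ⟨x + (⌊γ⌋ + 1) • β b, ?_, fun k => ?_⟩
    · rw [Submodule.Quotient.eq, add_sub_cancel_left]
      exact Submodule.smul_mem _ _ (Submodule.subset_span ⟨b, by simp, rfl⟩)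
    · have h := mem_zonotopeSlab_insert_diff_iff hbS hγ ((⌊γ⌋ + 1 + k : ℤ) : ℝ)
      have h1 : φ (x + (⌊γ⌋ + 1) • β b + k • β b) =
          φ x + ((⌊γ⌋ + 1 + k : ℤ) : ℝ) • (φ ∘ β) b := by
        rw [add_assoc, ← add_smul, map_add, map_zsmul, Int.cast_smul_eq_zsmul,
          Function.comp_apply]
      rw [h1, h, ← Int.floor_lt, ← Int.cast_natCast (R := ℝ) t, ← sub_le_iff_le_add,
        ← Int.cast_sub, ← Int.le_floor]
      omega
  choose y hy hyk using exists_lift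
  have hmk : ∀ (x : L) (k : ℤ), (Submodule.Quotient.mk (x + k • β b) :
      L ⧸ Submodule.span ℤ (β '' ((insert b A : Finset ι) : Set ι))) =
        Submodule.Quotient.mk x := by
    intro x k
    rw [Submodule.Quotient.eq, add_sub_cancel_left]
    exact Submodule.smul_mem _ _ (Submodule.subset_span ⟨b, by simp, rfl⟩)
  have hle : Submodule.span ℤ (β '' (A : Set ι)) ≤
      Submodule.span ℤ (β '' ((insert b A : Finset ι) : Set ι)) :=
    Submodule.span_mono (Set.image_mono (by simp))
  let F : slabClasses φ β t (insert b A) S × Fin t →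
      ↑(slabClasses φ β t A (insert b S) \ slabClasses φ β t A S) := fun p =>
    ⟨Submodule.Quotient.mk (y p.1 + (p.2 : ℤ) • β b), by
      rw [Set.mem_sdiff, mk_mem_slabClasses, mk_mem_slabClasses, hyk]
      exact ⟨by positivity, by exact_mod_cast p.2.2⟩⟩
  have hF : Function.Bijective F := by
    constructor
    · rintro ⟨q, j⟩ ⟨q', j'⟩ h
      have h1 := (Submodule.Quotient.eq _).1 (congrArg Subtype.val h)
      have h2 := (Submodule.Quotient.eq _).2 (hle h1)
      simp only [hmk, hy] at h2
      obtain rfl : q = q' := Subtype.ext h2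
      simp only [add_sub_add_left_eq_sub, ← sub_smul] at h1
      have h3 := map_mem_span_of_mem_span φ β h1
      rw [map_zsmul, ← Int.cast_smul_eq_zsmul ℝ] at h3
      by_contra hne
      refine hb ((Submodule.smul_mem_iff _ ?_).1 h3)
      rw [Int.cast_ne_zero, sub_ne_zero]
      intro h4
      exact hne (Prod.ext rfl (Fin.ext (by exact_mod_cast h4)))
    · rintro ⟨_, ⟨x, hx, rfl⟩, hx'⟩
      have hq : (Submodule.Quotient.mk x :
          L ⧸ Submodule.span ℤ (β '' ((insert b A : Finset ι) : Set ι))) ∈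
            slabClasses φ β t (insert b A) S := by
        rw [mk_mem_slabClasses, mem_zonotopeSlab_insert_left]
        obtain ⟨s, -, h⟩ := (mem_zonotopeSlab_insert hbS).1 hx
        exact ⟨-s, by rwa [neg_smul, ← sub_eq_add_neg]⟩
      have h1 := (Submodule.Quotient.eq _).1 (hy ⟨_, hq⟩).symm
      obtain ⟨k, a, ha, h1⟩ : ∃ k : ℤ, ∃ a ∈ Submodule.span ℤ (β '' (A : Set ι)),
          x - y ⟨_, hq⟩ = k • β b + a := by
        rwa [← Submodule.mem_span_insert, ← Set.image_insert_eq, ← Finset.coe_insert]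
      have h2 : (Submodule.Quotient.mk (y ⟨_, hq⟩ + k • β b) :
          L ⧸ Submodule.span ℤ (β '' (A : Set ι))) = Submodule.Quotient.mk x := by
        rw [eq_comm, Submodule.Quotient.eq, ← sub_sub, h1, add_sub_cancel_left]
        exact ha
      have h3 : (Submodule.Quotient.mk (y ⟨_, hq⟩ + k • β b) :
          L ⧸ Submodule.span ℤ (β '' (A : Set ι))) ∈
            slabClasses φ β t A (insert b S) \ slabClasses φ β t A S := by
        rw [h2]
        exact ⟨⟨x, hx, rfl⟩, hx'⟩
      rw [Set.mem_sdiff, mk_mem_slabClasses, mk_mem_slabClasses, hyk] at h3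
      lift k to ℕ using h3.1
      exact ⟨⟨⟨_, hq⟩, ⟨k, by exact_mod_cast h3.2⟩⟩, Subtype.ext h2⟩
  rw [← Nat.card_congr (Equiv.ofBijective F hF), Nat.card_prod, Nat.card_fin]

open scoped Classical in
/-- Deletion and contraction of a generator yield the count of slab classes as a sum over the
subsets of `S` that stay independent together with `A`. -/
theorem card_slabClasses [FiniteDimensional ℝ V] {φ : L →ₗ[ℤ] V}
    (hφ : ∀ M : ℝ, {x | ‖φ x‖ ≤ M}.Finite) (β : ι → L) (t : ℕ) (S : Finset ι) :
    ∀ A : Finset ι, Disjoint A S → LinearIndepOn ℝ (φ ∘ β) (A : Set ι) →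
      Nat.card (slabClasses φ β t A S) = ∑ X ∈ S.powerset,
        if LinearIndepOn ℝ (φ ∘ β) ((A ∪ X : Finset ι) : Set ι)
        then Nat.card (slabClasses φ β t (A ∪ X) ∅) * t ^ X.card else 0 := by
  induction S using Finset.induction_on with
  | empty =>
    intro A _ hA
    rw [Finset.powerset_empty, Finset.sum_singleton, Finset.union_empty, if_pos hA,
      Finset.card_empty, pow_zero, mul_one]
  | insert b S hbS ih =>
    intro A hd hA
    obtain ⟨hbA, hAS⟩ := Finset.disjoint_insert_right.1 hd
    have hAX : ∀ X, A ∪ insert b X = insert b A ∪ X := fun X => by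
      rw [Finset.union_insert, Finset.insert_union]
    rw [Finset.sum_powerset_insert hbS, ← ih A hAS hA]
    by_cases hb : φ (β b) ∈ Submodule.span ℝ ((φ ∘ β) '' (A : Set ι))
    · rw [slabClasses_insert_of_mem_span hbS hb, Finset.sum_eq_zero, add_zero]
      intro X _
      rw [if_neg]
      intro hX
      rw [hAX] at hX
      refine (hX.mono (t := insert b (A : Set ι)) ?_).notMem_span_of_insert
        (by simpa using hbA) hb
      rw [← Finset.coe_insert, Finset.coe_subset]
      exact Finset.subset_union_left
    · have hA' : LinearIndepOn ℝ (φ ∘ β) ((insert b A : Finset ι) : Set ι) := by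
        rw [Finset.coe_insert]
        exact hA.insert hb
      have hsub := slabClasses_subset_insert (φ := φ) (β := β) (t := t) (A := A) hbS
      have hcard : Nat.card (slabClasses φ β t A (insert b S)) =
          Nat.card (slabClasses φ β t A S) +
            Nat.card ↑(slabClasses φ β t A (insert b S) \ slabClasses φ β t A S) := by
        simp only [Nat.card_coe_set_eq]
        rw [add_comm, Set.ncard_sdiff_add_ncard_of_subset hsub (finite_slabClasses hφ β t _ _)]
      rw [hcard, card_slabClasses_insert_diff hbS hb,
        ih (insert b A) (Finset.disjoint_insert_left.2 ⟨hbS, hAS⟩) hA', Finset.sum_mul]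
      congr 1
      refine Finset.sum_congr rfl fun X hX => ?_
      rw [hAX, Finset.card_insert_of_notMem fun h => hbS (Finset.mem_powerset.1 hX h), ite_mul,
        zero_mul, pow_succ, mul_assoc]

end Zonotope

lemma finite_norm_intCast_le (n : ℕ) (M : ℝ) : {x | ‖intCast n x‖ ≤ M}.Finite := by
  refine (Set.finite_Icc (fun _ : Fin n => -⌊M⌋) (fun _ => ⌊M⌋)).subset fun x hx => ?_
  have h : ∀ i, |x i| ≤ ⌊M⌋ := fun i => by
    rw [Int.le_floor]
    refine le_trans ?_ ((norm_le_pi_norm (intCast n x) i).trans hx)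
    simp [intCast]
  exact ⟨fun i => (abs_le.1 (h i)).1, fun i => (abs_le.1 (h i)).2⟩

lemma card_slabClasses_empty (n r : ℕ) (β : Fin r → (Fin n → ℤ)) (t : ℕ) (X : Finset (Fin r)) :
    Nat.card (slabClasses (intCast n) β t X ∅) = hIndex n r β X := by
  unfold hIndex
  set Λ := Submodule.comap (intCast n) ((Submodule.span ℝ
    ((fun i => intCast n (β i)) '' (X : Set (Fin r)))).restrictScalars ℤ)
  set Γ := Submodule.span ℤ (β '' (X : Set (Fin r)))
  let F : (Λ ⧸ Γ.comap Λ.subtype) →ₗ[ℤ] _ := Submodule.mapQ (Γ.comap Λ.subtype) Γ Λ.subtype le_rfl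
  have hF : Function.Injective F := by
    rw [← LinearMap.ker_eq_bot, Submodule.ker_mapQ]
    simp
  have hrange : slabClasses (intCast n) β t X ∅ = Set.range F := by
    rw [slabClasses, zonotopeSlab_empty]
    ext q
    constructor
    · rintro ⟨x, hx, rfl⟩
      exact ⟨Submodule.Quotient.mk ⟨x, hx⟩, rfl⟩
    · rintro ⟨q, rfl⟩
      induction q using Submodule.Quotient.induction_on with
      | _ x => exact ⟨x.1, x.2, rfl⟩
  rw [hrange]
  exact (Nat.card_congr (Equiv.ofInjective F hF)).symm

open scoped Classical in
/-- (Stanley) For integer vectors `β 1, …, β r ∈ ℤ^n`, the Ehrhart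
counting function of the zonotope `𝒵 = ∑ conv {0, βᵢ}` satisfies, for every `t > 0`,
`#(t𝒵 ∩ ℤ^n) = ∑_X h(X) t^{|X|}`, the sum being over the linearly independent subsets
`X` of the multiset `{β 1, …, β r}` (i.e. subsets of the index set whose vectors are
linearly independent over `ℝ`), where `h(X) = [Λ_X : Γ_X]`. -/
theorem stanley_zonotope_ehrhart (n r : ℕ) (β : Fin r → (Fin n → ℤ)) (t : ℕ) (ht : 0 < t) :
    Nat.card {x : Fin n → ℤ |
        intCast n x ∈ (t : ℝ) • {y : Fin n → ℝ | ∃ c : Fin r → ℝ,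
          (∀ i, c i ∈ Set.Icc (0 : ℝ) 1) ∧ y = ∑ i, c i • intCast n (β i)}}
      = ∑ X : Finset (Fin r),
        if LinearIndependent ℝ (fun i : X => intCast n (β i))
        then hIndex n r β X * t ^ X.card else 0 := by
  have h := card_slabClasses (finite_norm_intCast_le n) β t Finset.univ ∅
    (Finset.disjoint_empty_left _) (by simp)
  simp only [Finset.empty_union, card_slabClasses_empty, Finset.powerset_univ] at h
  refine Eq.trans ?_ h
  have hinj : Function.Injective (Submodule.Quotient.mk :
      (Fin n → ℤ) → _ ⧸ Submodule.span ℤ (β '' ((∅ : Finset (Fin r)) : Set (Fin r)))) := by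
    intro x y hxy
    simpa [Submodule.Quotient.eq, sub_eq_zero] using hxy
  rw [slabClasses, Nat.card_image_of_injective hinj]
  have ht' : (0 : ℝ) < t := Nat.cast_pos.2 ht
  congr 2
  ext x
  simp only [zonotopeSlab, Set.mem_ofPred_eq, Finset.coe_empty, Set.image_empty,
    Submodule.span_empty, Submodule.mem_bot, sub_eq_zero, Set.mem_smul_set]
  constructor
  · rintro ⟨_, ⟨c, hc, rfl⟩, h⟩
    refine ⟨fun i => t * c i, fun i => ⟨mul_nonneg ht'.le (hc i).1,
      mul_le_of_le_one_right ht'.le (hc i).2⟩, ?_⟩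
    rw [← h, Finset.smul_sum]
    simp only [smul_smul, Function.comp_apply]
  · rintro ⟨c, hc, h⟩
    refine ⟨_, ⟨fun i => c i / t, fun i => ⟨div_nonneg (hc i).1 ht'.le,
      div_le_one_of_le₀ (hc i).2 ht'.le⟩, rfl⟩, ?_⟩
    rw [h, Finset.smul_sum]
    simp only [smul_smul, Function.comp_apply, mul_div_cancel₀ _ ht'.ne']
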